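/- Fix (p,q) ∈ ℤ². (a) If Im d' ∩ ker d'' ∩ A^{p,q} = Im d'd'' ∩ A^{p,q}, then ker d'' ∩ A^{p-1,q} = ((ker d' ∩ ker d'') + Im d'') ∩ A^{p-1,q} (i.e., the natural map H_{BC}^{p-1,q} → H_{d''}^{p-1,q} is surjective). (b) If ker d' ∩ Im d'' ∩ A^{p,q} = Im d'd'' ∩ A^{p,q}, then ker d' ∩ A^{p,q-1} = ((ker d' ∩ ker d'') + Im d') ∩ A^{p,q-1} (i.e., the natural map H_{BC}^{p,q-1} → H_{d'}^{p,q-1} is surjective). -/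

import Mathlib

open Submodule

/-- A double complex of complex vector spaces, realized as an internally bigraded
module `W = ⊕_{p,q} A p q` together with global differentials `d'`, `d''` of
bidegrees `(1,0)` and `(0,1)` satisfying `d'∘d' = 0`, `d''∘d'' = 0` and
`d'∘d'' + d''∘d' = 0`. -/
structure BiComplex (W : Type*) [AddCommGroup W] [Module ℂ W] where
  A : ℤ → ℤ → Submodule ℂ W
  d' : W →ₗ[ℂ] W
  d'' : W →ₗ[ℂ] W
  internal : DirectSum.IsInternal (fun pq : ℤ × ℤ => A pq.1 pq.2)
  map_d' : ∀ p q : ℤ, (A p q).map d' ≤ A (p + 1) q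
  map_d'' : ∀ p q : ℤ, (A p q).map d'' ≤ A p (q + 1)
  d'_sq : d' ∘ₗ d' = 0
  d''_sq : d'' ∘ₗ d'' = 0
  anticomm : d' ∘ₗ d'' + d'' ∘ₗ d' = 0

namespace BiComplex

variable {W : Type*} [AddCommGroup W] [Module ℂ W] (C : BiComplex W)

/-- `ker d' ∩ A^{p,q}` : the kernel of `d' : A^{p,q} → A^{p+1,q}`. -/
def kerd' (p q : ℤ) : Submodule ℂ W := LinearMap.ker C.d' ⊓ C.A p q

/-- `ker d'' ∩ A^{p,q}` : the kernel of `d'' : A^{p,q} → A^{p,q+1}`. -/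
def kerd'' (p q : ℤ) : Submodule ℂ W := LinearMap.ker C.d'' ⊓ C.A p q

/-- `Im d' ∩ A^{p,q} = d'(A^{p-1,q})`. -/
def imd' (p q : ℤ) : Submodule ℂ W := (C.A (p - 1) q).map C.d'

/-- `Im d'' ∩ A^{p,q} = d''(A^{p,q-1})`. -/
def imd'' (p q : ℤ) : Submodule ℂ W := (C.A p (q - 1)).map C.d''

/-- `Im d'd'' ∩ A^{p,q} = (d'∘d'')(A^{p-1,q-1})`. -/
def imd'd'' (p q : ℤ) : Submodule ℂ W := (C.A (p - 1) (q - 1)).map (C.d' ∘ₗ C.d'')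

/-- `ker d'd'' ∩ A^{p,q}` : the kernel of `d'∘d'' : A^{p,q} → A^{p+1,q+1}`. -/
def kerd'd'' (p q : ℤ) : Submodule ℂ W := LinearMap.ker (C.d' ∘ₗ C.d'') ⊓ C.A p q

/-- The `d'd''`-lemma at `(p,q)`:
`Im d' ∩ ker d'' ∩ A^{p,q} = ker d' ∩ Im d'' ∩ A^{p,q} = Im d'd'' ∩ A^{p,q}`. -/
def DDLemmaAt (p q : ℤ) : Prop :=
  C.imd' p q ⊓ C.kerd'' p q = C.imd'd'' p q ∧ C.kerd' p q ⊓ C.imd'' p q = C.imd'd'' p q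

/-- The total-degree piece `A^k = ⊕_{p+q=k} A^{p,q}`. -/
def Atot (k : ℤ) : Submodule ℂ W := ⨆ p : ℤ, C.A p (k - p)

/-- The total differential `d = d' + d''`. -/
def dtot : W →ₗ[ℂ] W := C.d' + C.d''

/-- `ker d ∩ A^k` : the kernel of `d : A^k → A^{k+1}`. -/
def kerdTot (k : ℤ) : Submodule ℂ W := LinearMap.ker C.dtot ⊓ C.Atot k

/-- `Im d ∩ A^k = d(A^{k-1})`. -/
def imdTot (k : ℤ) : Submodule ℂ W := (C.Atot (k - 1)).map C.dtot

/-- `ker d' ∩ ker d'' ∩ A^k = ⊕_{p+q=k} (ker d' ∩ ker d'' ∩ A^{p,q})`. -/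
def kerd'kerd''Tot (k : ℤ) : Submodule ℂ W :=
  ⨆ p : ℤ, (C.kerd' p (k - p) ⊓ C.kerd'' p (k - p))

/-- `Im d'd'' ∩ A^k = ⊕_{p+q=k} (Im d'd'' ∩ A^{p,q})`. -/
def imd'd''Tot (k : ℤ) : Submodule ℂ W := ⨆ p : ℤ, C.imd'd'' p (k - p)

/-- `ker d'd'' ∩ A^k = ⊕_{p+q=k} (ker d'd'' ∩ A^{p,q})`. -/
def kerd'd''Tot (k : ℤ) : Submodule ℂ W := ⨆ p : ℤ, C.kerd'd'' p (k - p)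

/-- `Im d' ∩ A^k = ⊕_{p+q=k} (Im d' ∩ A^{p,q})`. -/
def imd'Tot (k : ℤ) : Submodule ℂ W := ⨆ p : ℤ, C.imd' p (k - p)

/-- `Im d'' ∩ A^k = ⊕_{p+q=k} (Im d'' ∩ A^{p,q})`. -/
def imd''Tot (k : ℤ) : Submodule ℂ W := ⨆ p : ℤ, C.imd'' p (k - p)

/-- The double complex is totally bounded: `A^{p,q} = 0` for `|p| > N` or `|q| > N`. -/
def TotallyBounded : Prop :=
  ∃ N : ℕ, ∀ p q : ℤ, ((N : ℤ) < |p| ∨ (N : ℤ) < |q|) → C.A p q = ⊥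

end BiComplex

/-- The quotient vector space `S / T` of a submodule `S` by (the trace of) a
submodule `T ≤ S`. -/
abbrev quotSub {W : Type*} [AddCommGroup W] [Module ℂ W] (S T : Submodule ℂ W) :=
  S ⧸ (Submodule.comap S.subtype T)

namespace BiComplex

variable {W : Type*} [AddCommGroup W] [Module ℂ W] (C : BiComplex W)

lemma d'_d'_apply (x : W) : C.d' (C.d' x) = 0 :=
  LinearMap.congr_fun C.d'_sq x

lemma d''_d''_apply (x : W) : C.d'' (C.d'' x) = 0 :=
  LinearMap.congr_fun C.d''_sq x

lemma d''_d'_apply (x : W) : C.d'' (C.d' x) = -C.d' (C.d'' x) :=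
  eq_neg_of_add_eq_zero_right (LinearMap.congr_fun C.anticomm x)

lemma imd'_le_A (p q : ℤ) : C.imd' p q ≤ C.A p q := by
  simpa [imd'] using C.map_d' (p - 1) q

lemma imd''_le_A (p q : ℤ) : C.imd'' p q ≤ C.A p q := by
  simpa [imd''] using C.map_d'' p (q - 1)

lemma imd'_le_kerd' (p q : ℤ) : C.imd' p q ≤ C.kerd' p q := by
  refine le_inf ?_ (C.imd'_le_A p q)
  rintro _ ⟨y, -, rfl⟩
  exact C.d'_d'_apply y

lemma imd''_le_kerd'' (p q : ℤ) : C.imd'' p q ≤ C.kerd'' p q := by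
  refine le_inf ?_ (C.imd''_le_A p q)
  rintro _ ⟨y, -, rfl⟩
  exact C.d''_d''_apply y

/-- If every `d''`-closed element of `Im d'` in bidegree `(p,q)` is `d'd''`-exact, then every
`d''`-closed element of bidegree `(p-1,q)` is closed for both differentials up to `Im d''`. -/
lemma kerd''_eq_sup {p q : ℤ} (h : C.imd' p q ⊓ C.kerd'' p q ≤ C.imd'd'' p q) :
    C.kerd'' (p - 1) q = (C.kerd' (p - 1) q ⊓ C.kerd'' (p - 1) q) ⊔ C.imd'' (p - 1) q := by
  refine le_antisymm (fun x hx => ?_) (sup_le inf_le_right (C.imd''_le_kerd'' _ _))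
  have hx0 : C.d'' x = 0 := hx.1
  have hd'x : C.d' x ∈ C.imd' p q := mem_map_of_mem hx.2
  have hd''d'x : C.d'' (C.d' x) = 0 := by rw [d''_d'_apply, hx0, map_zero, neg_zero]
  obtain ⟨y, hy, hyx⟩ := h ⟨hd'x, hd''d'x, C.imd'_le_A p q hd'x⟩
  have hd''y : C.d'' y ∈ C.imd'' (p - 1) q := mem_map_of_mem hy
  have hsub : x - C.d'' y ∈ C.kerd'' (p - 1) q := sub_mem hx (C.imd''_le_kerd'' _ _ hd''y)
  have hd'sub : C.d' (x - C.d'' y) = 0 := by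
    rw [map_sub, sub_eq_zero]
    exact hyx.symm
  exact mem_sup.2 ⟨x - C.d'' y, ⟨⟨hd'sub, hsub.2⟩, hsub⟩, C.d'' y, hd''y, sub_add_cancel _ _⟩

/-- If every `d'`-closed element of `Im d''` in bidegree `(p,q)` is `d'd''`-exact, then every
`d'`-closed element of bidegree `(p,q-1)` is closed for both differentials up to `Im d'`. -/
lemma kerd'_eq_sup {p q : ℤ} (h : C.kerd' p q ⊓ C.imd'' p q ≤ C.imd'd'' p q) :
    C.kerd' p (q - 1) = (C.kerd' p (q - 1) ⊓ C.kerd'' p (q - 1)) ⊔ C.imd' p (q - 1) := by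
  refine le_antisymm (fun x hx => ?_) (sup_le inf_le_left (C.imd'_le_kerd' _ _))
  have hx0 : C.d' x = 0 := hx.1
  have hd''x : C.d'' x ∈ C.imd'' p q := mem_map_of_mem hx.2
  have hd'd''x : C.d' (C.d'' x) = 0 := by
    rw [← neg_eq_zero, ← d''_d'_apply, hx0, map_zero]
  obtain ⟨y, hy, hyx⟩ := h ⟨⟨hd'd''x, C.imd''_le_A p q hd''x⟩, hd''x⟩
  have hd'y : C.d' y ∈ C.imd' p (q - 1) := mem_map_of_mem hy
  have hadd : x + C.d' y ∈ C.kerd' p (q - 1) := add_mem hx (C.imd'_le_kerd' _ _ hd'y)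
  have hd''add : C.d'' (x + C.d' y) = 0 := by
    rw [map_add, d''_d'_apply, ← sub_eq_add_neg, sub_eq_zero]
    exact hyx.symm
  exact mem_sup.2 ⟨x + C.d' y, ⟨hadd, hd''add, hadd.2⟩, -C.d' y, neg_mem hd'y,
    add_neg_cancel_right _ _⟩

end BiComplex

/-- Fix `(p,q)`.
(a) If `Im d' ∩ ker d'' ∩ A^{p,q} = Im d'd'' ∩ A^{p,q}`, then
`ker d'' ∩ A^{p-1,q} = ((ker d' ∩ ker d'') + Im d'') ∩ A^{p-1,q}` (i.e. the map
`H_BC^{p-1,q} → H_{d''}^{p-1,q}` is surjective).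
(b) If `ker d' ∩ Im d'' ∩ A^{p,q} = Im d'd'' ∩ A^{p,q}`, then
`ker d' ∩ A^{p,q-1} = ((ker d' ∩ ker d'') + Im d') ∩ A^{p,q-1}` (i.e. the map
`H_BC^{p,q-1} → H_{d'}^{p,q-1}` is surjective). -/
theorem bicomplex_phi_pm_inj_implies_surj
    {W : Type*} [AddCommGroup W] [Module ℂ W] (C : BiComplex W) (p q : ℤ) :
    (C.imd' p q ⊓ C.kerd'' p q = C.imd'd'' p q →
      C.kerd'' (p - 1) q =
        (C.kerd' (p - 1) q ⊓ C.kerd'' (p - 1) q) ⊔ C.imd'' (p - 1) q) ∧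
    (C.kerd' p q ⊓ C.imd'' p q = C.imd'd'' p q →
      C.kerd' p (q - 1) =
        (C.kerd' p (q - 1) ⊓ C.kerd'' p (q - 1)) ⊔ C.imd' p (q - 1)) :=
  ⟨fun h => C.kerd''_eq_sup h.le, fun h => C.kerd'_eq_sup h.le⟩
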